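/- Assume f is strongly convex with parameter μ > 0 and attains its minimum at x⋆ (so ∇f(x⋆) = 0). Let m ≥ 1, M ≥ 0, π(k) := k − (k mod m), and let x_0, x_1, … be iterates such that for every k ≥ 0, x_{k+1} satisfies the lazy cubic Newton step stationarity conditions T_M(x_k, x_{π(k)}). If ‖∇f(x_0)‖ ≤ μ²/(2·(M + 3L)), then for all integers t ≥ 0 and 0 ≤ i ≤ m: ‖∇f(x_{t·m + i})‖ ≤ (μ²/(M + 3L)) · (1/2)^{(1 + i)·(1 + m)^t}. -/

import Mathlib

open scoped InnerProductSpace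

/-- Quadratic Taylor remainder of a map whose derivative is Lipschitz. -/
theorem norm_sub_sub_fderiv_le_of_lipschitz
    {E F : Type*} [NormedAddCommGroup E] [NormedSpace ℝ E]
    [NormedAddCommGroup F] [NormedSpace ℝ F] {g : E → F} {H : E → E →L[ℝ] F} {L : ℝ}
    (hH : ∀ y, HasFDerivAt g (H y) y)
    (hLip : ∀ y₁ y₂, ‖H y₁ - H y₂‖ ≤ L * ‖y₁ - y₂‖) (x s : E) :
    ‖g (x + s) - g x - H x s‖ ≤ L / 2 * ‖s‖ ^ 2 := by
  have hd : ∀ t : ℝ, HasDerivAt (fun t : ℝ => g (x + t • s) - g x - t • H x s)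
      (H (x + t • s) s - H x s) t := by
    intro t
    have h1 : HasDerivAt (fun t : ℝ => x + t • s) s t := by
      simpa using ((hasDerivAt_id t).smul_const s).const_add x
    have h2 : HasDerivAt (fun t : ℝ => t • H x s) (H x s) t := by
      simpa using (hasDerivAt_id t).smul_const (H x s)
    exact (((hH (x + t • s)).comp_hasDerivAt t h1).sub_const (g x)).sub h2
  have hB : ∀ t : ℝ, HasDerivAt (fun t : ℝ => L / 2 * ‖s‖ ^ 2 * t ^ 2) (L * ‖s‖ ^ 2 * t) t := by
    intro t
    exact ((hasDerivAt_pow 2 t).const_mul (L / 2 * ‖s‖ ^ 2)).congr_deriv (by push_cast; ring)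
  have key := image_norm_le_of_norm_deriv_right_le_deriv_boundary (a := 0) (b := 1)
    (fun t _ => (hd t).continuousAt.continuousWithinAt)
    (fun t _ => (hd t).hasDerivWithinAt) (by simp) hB
    (fun t ht => by
      calc ‖H (x + t • s) s - H x s‖ = ‖(H (x + t • s) - H x) s‖ := rfl
        _ ≤ ‖H (x + t • s) - H x‖ * ‖s‖ := ContinuousLinearMap.le_opNorm _ _
        _ ≤ L * ‖x + t • s - x‖ * ‖s‖ := by gcongr; exact hLip _ _
        _ = L * ‖s‖ ^ 2 * t := by
          rw [add_sub_cancel_left, norm_smul, Real.norm_of_nonneg ht.1]; ring)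
    (Set.right_mem_Icc.2 zero_le_one)
  simpa using key

/-- A map whose derivative is bounded below by `μ` in the quadratic form sense expands
distances by a factor of at least `μ`. -/
theorem mul_norm_sub_le_norm_sub_of_le_inner_fderiv
    {E : Type*} [NormedAddCommGroup E] [InnerProductSpace ℝ E]
    {g : E → E} {H : E → E →L[ℝ] E} {μ : ℝ}
    (hH : ∀ y, HasFDerivAt g (H y) y)
    (hsc : ∀ y h, μ * ‖h‖ ^ 2 ≤ ⟪H y h, h⟫_ℝ) (x y : E) :
    μ * ‖x - y‖ ≤ ‖g x - g y‖ := by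
  have hd : ∀ t : ℝ, HasDerivAt (fun t : ℝ => ⟪g (y + t • (x - y)), x - y⟫_ℝ)
      ⟪H (y + t • (x - y)) (x - y), x - y⟫_ℝ t := by
    intro t
    have h1 : HasDerivAt (fun t : ℝ => y + t • (x - y)) (x - y) t := by
      simpa using ((hasDerivAt_id t).smul_const (x - y)).const_add y
    simpa using ((hH (y + t • (x - y))).comp_hasDerivAt t h1).inner ℝ
      (hasDerivAt_const t (x - y))
  obtain ⟨c, -, hc⟩ := exists_hasDerivAt_eq_slope _ _ zero_lt_one
    (fun t _ => (hd t).continuousAt.continuousWithinAt) (fun t _ => hd t)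
  have h1 := hsc (y + c • (x - y)) (x - y)
  simp only [hc, one_smul, zero_smul, add_zero, sub_zero, div_one, add_sub_cancel,
    ← inner_sub_left] at h1
  have h2 := real_inner_le_norm (g x - g y) (x - y)
  rcases (norm_nonneg (x - y)).eq_or_lt with h0 | h0
  · rw [← h0, mul_zero]; exact norm_nonneg _
  · exact le_of_mul_le_mul_right (by linarith) h0

/-- One lazy cubic Newton step is no longer than the gradient norm divided by `μ`. -/
theorem mul_norm_le_norm_of_cubic_step
    {E : Type*} [NormedAddCommGroup E] [InnerProductSpace ℝ E]
    {A : E →L[ℝ] E} {μ M : ℝ} (hM : 0 ≤ M)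
    (hA : ∀ h, μ * ‖h‖ ^ 2 ≤ ⟪A h, h⟫_ℝ) {v s : E}
    (hs : v + A s + (M * ‖s‖ / 2) • s = 0) : μ * ‖s‖ ≤ ‖v‖ := by
  have h1 : ⟪v, s⟫_ℝ + ⟪A s, s⟫_ℝ + M * ‖s‖ / 2 * ‖s‖ ^ 2 = 0 := by
    rw [← real_inner_self_eq_norm_sq, ← real_inner_smul_left, ← inner_add_left,
      ← inner_add_left, hs, inner_zero_left]
  have h2 := neg_le_of_abs_le (abs_real_inner_le_norm v s)
  have h3 : 0 ≤ M * ‖s‖ / 2 * ‖s‖ ^ 2 := by positivity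
  rcases (norm_nonneg s).eq_or_lt with h0 | h0
  · rw [← h0, mul_zero]; exact norm_nonneg _
  · exact le_of_mul_le_mul_right (by linarith [hA s]) h0

/-- Gradient norm after one lazy cubic Newton step from `x` with Hessian snapshot at `z`. -/
theorem norm_gradient_le_of_lazy_cubic_step
    {E : Type*} [NormedAddCommGroup E] [InnerProductSpace ℝ E]
    {g : E → E} {H : E → E →L[ℝ] E} {L μ M : ℝ} (hL : 0 < L) (hμ : 0 < μ) (hM : 0 ≤ M)
    (hH : ∀ y, HasFDerivAt g (H y) y)
    (hLip : ∀ y₁ y₂, ‖H y₁ - H y₂‖ ≤ L * ‖y₁ - y₂‖)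
    (hsc : ∀ y h, μ * ‖h‖ ^ 2 ≤ ⟪H y h, h⟫_ℝ)
    {xstar : E} (hgstar : g xstar = 0) {x z T : E}
    (hstep : g x + H z (T - x) + (M * ‖T - x‖ / 2) • (T - x) = 0) :
    μ ^ 2 * ‖g T‖ ≤ (M + 3 * L) / 2 * ‖g x‖ ^ 2 + L * ‖g x‖ * ‖g z‖ := by
  have hr := mul_norm_le_norm_of_cubic_step hM (hsc z) hstep
  have hx := mul_norm_sub_le_norm_sub_of_le_inner_fderiv hH hsc x xstar
  have hz := mul_norm_sub_le_norm_sub_of_le_inner_fderiv hH hsc z xstar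
  have htaylor := norm_sub_sub_fderiv_le_of_lipschitz hH hLip x (T - x)
  rw [hgstar, sub_zero] at hx hz
  rw [add_sub_cancel] at htaylor
  set s := T - x with hs
  have hxz : μ * ‖x - z‖ ≤ ‖g x‖ + ‖g z‖ := by
    have := norm_sub_le_norm_sub_add_norm_sub x xstar z
    rw [norm_sub_rev xstar z] at this
    nlinarith
  have hlazy : ‖(H x - H z) s‖ ≤ L * ‖x - z‖ * ‖s‖ :=
    (ContinuousLinearMap.le_opNorm _ _).trans (by gcongr; exact hLip x z)
  have hcubic : ‖(M * ‖s‖ / 2) • s‖ = M / 2 * ‖s‖ ^ 2 := by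
    rw [norm_smul, Real.norm_of_nonneg (by positivity)]; ring
  have hsplit : g T = (g T - g x - H x s) + (H x - H z) s - (M * ‖s‖ / 2) • s := by
    rw [sub_apply, ← sub_eq_zero, ← hstep]
    abel
  have hT : ‖g T‖ ≤ (M + L) / 2 * ‖s‖ ^ 2 + L * ‖x - z‖ * ‖s‖ := by
    have h1 := norm_sub_le ((g T - g x - H x s) + (H x - H z) s) ((M * ‖s‖ / 2) • s)
    have h2 := norm_add_le (g T - g x - H x s) ((H x - H z) s)
    rw [← hsplit] at h1
    linarith
  calc μ ^ 2 * ‖g T‖ ≤ μ ^ 2 * ((M + L) / 2 * ‖s‖ ^ 2 + L * ‖x - z‖ * ‖s‖) := by gcongr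
    _ = (M + L) / 2 * (μ * ‖s‖) ^ 2 + L * ((μ * ‖x - z‖) * (μ * ‖s‖)) := by ring
    _ ≤ (M + L) / 2 * ‖g x‖ ^ 2 + L * ((‖g x‖ + ‖g z‖) * ‖g x‖) := by gcongr
    _ = _ := by ring

theorem lazy_cubic_local_superlinear
    {E : Type*} [NormedAddCommGroup E] [InnerProductSpace ℝ E] [FiniteDimensional ℝ E]
    (f : E → ℝ) (g : E → E) (H : E → E →L[ℝ] E) (L : ℝ)
    (hL : 0 < L) (hf : ContDiff ℝ 2 f)
    (hg : ∀ y, HasGradientAt f (g y) y)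
    (hH : ∀ y, HasFDerivAt g (H y) y)
    (hsym : ∀ y u v, ⟪H y u, v⟫_ℝ = ⟪u, H y v⟫_ℝ)
    (hLip : ∀ y₁ y₂, ‖H y₁ - H y₂‖ ≤ L * ‖y₁ - y₂‖)
    (μ : ℝ) (hμ : 0 < μ)
    (hsc : ∀ y h, μ * ‖h‖ ^ 2 ≤ ⟪H y h, h⟫_ℝ)
    (xstar : E) (hmin : ∀ y, f xstar ≤ f y) (hgstar : g xstar = 0)
    (m : ℕ) (hm : 1 ≤ m) (M : ℝ) (hM : 0 ≤ M) (x : ℕ → E)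
    (hstep : ∀ k : ℕ,
      g (x k) + H (x (k - k % m)) (x (k + 1) - x k)
        + (M * ‖x (k + 1) - x k‖ / 2) • (x (k + 1) - x k) = 0)
    (hpsd : ∀ k : ℕ, ∀ h : E,
      0 ≤ ⟪H (x (k - k % m)) h, h⟫_ℝ + M * ‖x (k + 1) - x k‖ / 2 * ‖h‖ ^ 2)
    (hinit : ‖g (x 0)‖ ≤ μ ^ 2 / (2 * (M + 3 * L))) :
    ∀ t : ℕ, ∀ i ≤ m,
      ‖g (x (t * m + i))‖ ≤ μ ^ 2 / (M + 3 * L) * (1 / 2 : ℝ) ^ ((1 + i) * (1 + m) ^ t) := by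
  have hC : 0 < M + 3 * L := by positivity
  set c := μ ^ 2 / (M + 3 * L) with hc
  have hc0 : 0 < c := by positivity
  have hcC : c * (M + 3 * L) = μ ^ 2 := div_mul_cancel₀ _ hC.ne'
  have phase : ∀ (t : ℕ) (q : ℝ), 0 ≤ q → q ≤ 1 → ‖g (x (t * m))‖ ≤ c * q →
      ∀ i ≤ m, ‖g (x (t * m + i))‖ ≤ c * q ^ (1 + i) := by
    intro t q hq0 hq1 hq i
    induction i with
    | zero => simpa using hq
    | succ i ih =>
      intro hi
      have hx := ih (by lia)
      have hsnap : t * m + i - (t * m + i) % m = t * m := by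
        rw [Nat.mul_add_mod_self_right, Nat.mod_eq_of_lt hi, Nat.add_sub_cancel]
      have hk := hstep (t * m + i)
      rw [hsnap] at hk
      have hrec := norm_gradient_le_of_lazy_cubic_step hL hμ hM hH hLip hsc hgstar hk
      have hx' : ‖g (x (t * m + i))‖ ≤ c * q := by
        refine hx.trans (mul_le_mul_of_nonneg_left ?_ hc0.le)
        simpa using pow_le_pow_of_le_one hq0 hq1 (Nat.le_add_right 1 i)
      refine le_of_mul_le_mul_left (hrec.trans ?_) (sq_pos_of_pos hμ)
      calc (M + 3 * L) / 2 * ‖g (x (t * m + i))‖ ^ 2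
            + L * ‖g (x (t * m + i))‖ * ‖g (x (t * m))‖
          = (M + 3 * L) / 2 * (‖g (x (t * m + i))‖ * ‖g (x (t * m + i))‖)
            + L * (‖g (x (t * m + i))‖ * ‖g (x (t * m))‖) := by ring
        _ ≤ (M + 3 * L) / 2 * ((c * q ^ (1 + i)) * (c * q))
            + L * ((c * q ^ (1 + i)) * (c * q)) := by gcongr
        _ = ((M + 3 * L) / 2 + L) * ((c * q ^ (1 + i)) * (c * q)) := by ring
        _ ≤ (M + 3 * L) * ((c * q ^ (1 + i)) * (c * q)) := by
          gcongr ?_ * _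
          linarith
        _ = c * (M + 3 * L) * (c * q ^ (1 + (i + 1))) := by ring
        _ = μ ^ 2 * (c * q ^ (1 + (i + 1))) := by rw [hcC]
  have start : ∀ t : ℕ, ‖g (x (t * m))‖ ≤ c * (1 / 2 : ℝ) ^ ((1 + m) ^ t) := by
    intro t
    induction t with
    | zero =>
      have : c * (1 / 2) = μ ^ 2 / (2 * (M + 3 * L)) := by rw [hc]; field_simp
      simpa [← this] using hinit
    | succ t ih =>
      have := phase t _ (by positivity) (pow_le_one₀ (by norm_num) (by norm_num)) ih m le_rfl
      rwa [← pow_mul, ← pow_succ, ← Nat.succ_mul] at this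
  intro t i hi
  have := phase t _ (by positivity) (pow_le_one₀ (by norm_num) (by norm_num)) (start t) i hi
  rwa [← pow_mul, mul_comm ((1 + m) ^ t)] at this
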